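/- Let v ∈ Σ be a positive real scalar multiple of v(w) for some finite word w over {0,1,2,3}. Then there exist a unique real ℓ_v > 0 and a unique normalized word u over {0,1,2,3} such that v = ℓ_v·v(u). Moreover, for every finite word u over {0,1,2,3} there exist natural numbers a, b, c, d with v(u) = (a+bφ, c+dφ)ᵀ. -/

import Mathlib

noncomputable section
open Matrix

noncomputable def φ : ℝ := (1 + Real.sqrt 5) / 2

noncomputable def σ : Fin 4 → Matrix (Fin 2) (Fin 2) ℝ
  | 0 => !![1, φ; 0, 1]
  | 1 => !![φ, φ; 1, φ]
  | 2 => !![φ, 1; φ, φ]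
  | 3 => !![1, 0; φ, 1]

abbrev Word := List (Fin 4)

noncomputable def vword (w : Word) : Fin 2 → ℝ := ((w.map σ).prod).mulVec ![1, 0]

def Normalized (w : Word) : Prop := ∀ h : w ≠ [], w.getLast h ≠ 0

def Cone : Set (Fin 2 → ℝ) := {p | 0 < p 0 ∧ 0 ≤ p 1}

theorem aux_phi_sq : φ * φ = φ + 1 := by
  unfold φ
  have h : Real.sqrt 5 * Real.sqrt 5 = 5 := Real.mul_self_sqrt (by norm_num)
  linarith

theorem aux_phi_pos : 0 < φ := by
  unfold φ
  positivity

theorem aux_nil : vword [] = ![1, 0] := by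
  simp [vword]

theorem aux_cons (k : Fin 4) (t : Word) : vword (k :: t) = (σ k).mulVec (vword t) := by
  simp only [vword, List.map_cons, List.prod_cons, Matrix.mulVec_mulVec]

theorem aux_snoc (t : Word) : vword (t ++ [0]) = vword t := by
  have h : (σ 0).mulVec ![1, 0] = ![1, 0] := by
    ext i; fin_cases i <;> simp [σ]
  simp only [vword, List.map_append, List.prod_append, List.map_cons, List.map_nil,
    List.prod_cons, List.prod_nil, mul_one]
  rw [← Matrix.mulVec_mulVec, h]

theorem aux_s0 (p : Fin 2 → ℝ) : (σ 0).mulVec p = ![p 0 + φ * p 1, p 1] := by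
  ext i; fin_cases i <;> simp [σ, Matrix.mulVec, dotProduct, Fin.sum_univ_two]

theorem aux_s1 (p : Fin 2 → ℝ) : (σ 1).mulVec p = ![φ * p 0 + φ * p 1, p 0 + φ * p 1] := by
  ext i; fin_cases i <;> simp [σ, Matrix.mulVec, dotProduct, Fin.sum_univ_two]

theorem aux_s2 (p : Fin 2 → ℝ) : (σ 2).mulVec p = ![φ * p 0 + p 1, φ * p 0 + φ * p 1] := by
  ext i; fin_cases i <;> simp [σ, Matrix.mulVec, dotProduct, Fin.sum_univ_two]

theorem aux_s3 (p : Fin 2 → ℝ) : (σ 3).mulVec p = ![p 0, φ * p 0 + p 1] := by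
  ext i; fin_cases i <;> simp [σ, Matrix.mulVec, dotProduct, Fin.sum_univ_two]

theorem aux_cone (w : Word) : 0 < vword w 0 ∧ 0 ≤ vword w 1 := by
  induction w with
  | nil => simp [aux_nil]
  | cons k t ih =>
    obtain ⟨h0, h1⟩ := ih
    have := aux_phi_pos
    rw [aux_cons]
    fin_cases k
    · simp only [Fin.zero_eta, aux_s0]; constructor <;> simp <;> positivity
    · simp only [Fin.mk_one, aux_s1]; constructor <;> simp <;> positivity
    · simp only [Fin.reduceFinMk, aux_s2]; constructor <;> simp <;> positivity
    · simp only [Fin.reduceFinMk, aux_s3]; constructor <;> simp <;> positivity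

theorem aux_nat (u : Word) :
    ∃ a b c d : ℕ, vword u = ![(a : ℝ) + b * φ, (c : ℝ) + d * φ] := by
  induction u with
  | nil => exact ⟨1, 0, 0, 0, by simp [aux_nil]⟩
  | cons k t ih =>
    obtain ⟨a, b, c, d, h⟩ := ih
    have hp := aux_phi_sq
    rw [aux_cons, h]
    fin_cases k
    · refine ⟨a + d, b + c + d, c, d, ?_⟩
      simp only [Fin.zero_eta, aux_s0]
      ext i; fin_cases i <;> simp <;> linear_combination (d : ℝ) * hp
    · refine ⟨b + d, a + b + c + d, a + d, b + c + d, ?_⟩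
      simp only [Fin.mk_one, aux_s1]
      ext i; fin_cases i
      · simp; linear_combination (b + d : ℝ) * hp
      · simp; linear_combination (d : ℝ) * hp
    · refine ⟨b + c, a + b + d, b + d, a + b + c + d, ?_⟩
      simp only [Fin.reduceFinMk, aux_s2]
      ext i; fin_cases i
      · simp; linear_combination (b : ℝ) * hp
      · simp; linear_combination (b + d : ℝ) * hp
    · refine ⟨a, b, b + c, a + b + d, ?_⟩
      simp only [Fin.reduceFinMk, aux_s3]
      ext i; fin_cases i
      · simp
      · simp; linear_combination (b : ℝ) * hp

def auxCross (p q : Fin 2 → ℝ) : ℝ := p 0 * q 1 - p 1 * q 0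

theorem aux_cross_same (k : Fin 4) (p q : Fin 2 → ℝ) :
    auxCross ((σ k).mulVec p) ((σ k).mulVec q) = auxCross p q := by
  have hp := aux_phi_sq
  fin_cases k
  · simp only [Fin.zero_eta, aux_s0]; simp [auxCross]; ring
  · simp only [Fin.mk_one, aux_s1]; simp [auxCross]
    linear_combination (p 0 * q 1 - p 1 * q 0) * hp
  · simp only [Fin.reduceFinMk, aux_s2]; simp [auxCross]
    linear_combination (p 0 * q 1 - p 1 * q 0) * hp
  · simp only [Fin.reduceFinMk, aux_s3]; simp [auxCross]; ring

theorem aux_cross_lt (j k : Fin 4) (hjk : j < k) (p q : Fin 2 → ℝ)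
    (hp0 : 0 < p 0) (hp1 : 0 ≤ p 1) (hq0 : 0 < q 0) (hq1 : 0 ≤ q 1) :
    0 < auxCross ((σ j).mulVec p) ((σ k).mulVec q) := by
  have hp := aux_phi_sq
  have h := aux_phi_pos
  have a1 : 0 < p 0 * q 0 := by positivity
  have a2 : 0 ≤ p 0 * q 1 := by positivity
  have a3 : 0 ≤ p 1 * q 0 := by positivity
  have a4 : 0 ≤ p 1 * q 1 := by positivity
  have b1 : 0 < φ * (p 0 * q 0) := by positivity
  have b2 : 0 ≤ φ * (p 0 * q 1) := by positivity
  have b3 : 0 ≤ φ * (p 1 * q 0) := by positivity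
  have b4 : 0 ≤ φ * (p 1 * q 1) := by positivity
  have e1 : φ * φ * (p 0 * q 0) = (φ + 1) * (p 0 * q 0) := by rw [hp]
  have e2 : φ * φ * (p 0 * q 1) = (φ + 1) * (p 0 * q 1) := by rw [hp]
  have e3 : φ * φ * (p 1 * q 0) = (φ + 1) * (p 1 * q 0) := by rw [hp]
  have e4 : φ * φ * (p 1 * q 1) = (φ + 1) * (p 1 * q 1) := by rw [hp]
  fin_cases j <;> fin_cases k <;> first
    | (exfalso; revert hjk; decide)
    | (simp only [Fin.zero_eta, Fin.mk_one, Fin.reduceFinMk, aux_s0, aux_s1, aux_s2, aux_s3]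
       simp only [auxCross, Matrix.cons_val_zero, Matrix.cons_val_one]
       nlinarith)

theorem aux_anti (p q : Fin 2 → ℝ) : auxCross p q = - auxCross q p := by
  unfold auxCross; ring

theorem aux_tail {k : Fin 4} {t : Word} (h : Normalized (k :: t)) : Normalized t := by
  intro ht
  have := h (by simp)
  rwa [List.getLast_cons ht] at this

theorem aux_zero (u : Word) (hn : Normalized u) (h : vword u 1 = 0) : u = [] := by
  induction u with
  | nil => rfl
  | cons k t ih =>
    exfalso
    obtain ⟨h0, h1⟩ := aux_cone t
    have hφ := aux_phi_pos
    rw [aux_cons] at h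
    by_cases hk : k = 0
    · subst hk
      rw [aux_s0] at h
      have ht := ih (aux_tail hn) (by simpa using h)
      subst ht
      exact hn (by simp) (by simp)
    · have h3 : 0 < φ * vword t 0 := by positivity
      have h4 : 0 ≤ φ * vword t 1 := by positivity
      fin_cases k
      · exact hk rfl
      · simp only [Fin.mk_one, aux_s1] at h; simp at h; linarith
      · simp only [Fin.reduceFinMk, aux_s2] at h; simp at h; linarith
      · simp only [Fin.reduceFinMk, aux_s3] at h; simp at h; linarith

theorem aux_uniq (u w : Word) (hu : Normalized u) (hw : Normalized w)
    (h : auxCross (vword u) (vword w) = 0) : u = w := by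
  induction u generalizing w with
  | nil =>
    rw [aux_nil] at h
    exact (aux_zero w hw (by simpa [auxCross] using h)).symm
  | cons j s ih =>
    cases w with
    | nil =>
      rw [aux_nil] at h
      exact aux_zero _ hu (by simpa [auxCross] using h)
    | cons k t =>
      rw [aux_cons, aux_cons] at h
      obtain ⟨a0, a1⟩ := aux_cone s
      obtain ⟨b0, b1⟩ := aux_cone t
      rcases lt_trichotomy j k with hjk | hjk | hjk
      · exact absurd h (aux_cross_lt j k hjk _ _ a0 a1 b0 b1).ne'
      · subst hjk
        rw [aux_cross_same] at h
        rw [ih t (aux_tail hu) (aux_tail hw) h]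
      · rw [aux_anti] at h
        have := aux_cross_lt k j hjk _ _ b0 b1 a0 a1
        linarith

theorem aux_norm (w : Word) : ∃ u, Normalized u ∧ vword u = vword w := by
  induction w using List.reverseRecOn with
  | nil => exact ⟨[], fun h => absurd rfl h, rfl⟩
  | append_singleton t k ih =>
    by_cases hk : k = 0
    · subst hk
      rw [aux_snoc]; exact ih
    · exact ⟨t ++ [k], fun _ => by simpa using hk, rfl⟩

theorem stmt9 (v : Fin 2 → ℝ) (hv : v ∈ Cone)
    (h : ∃ ℓ : ℝ, 0 < ℓ ∧ ∃ w : Word, v = ℓ • vword w) :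
    (∃! p : ℝ × Word, 0 < p.1 ∧ Normalized p.2 ∧ v = p.1 • vword p.2) ∧
    ∀ u : Word, ∃ a b c d : ℕ, vword u = ![(a : ℝ) + b * φ, (c : ℝ) + d * φ] := by
  refine ⟨?_, aux_nat⟩
  obtain ⟨l, hl, w, rfl⟩ := h
  obtain ⟨u, hu, huw⟩ := aux_norm w
  refine ⟨(l, u), ⟨hl, hu, by simp only [huw]⟩, ?_⟩
  rintro ⟨m, z⟩ ⟨hm, hz, he⟩
  simp only at hm hz he
  rw [← huw] at he
  have e0 : l * vword u 0 = m * vword z 0 := by simpa using congrFun he 0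
  have e1 : l * vword u 1 = m * vword z 1 := by simpa using congrFun he 1
  have hc : auxCross (vword z) (vword u) = 0 := by
    have : l * m * auxCross (vword z) (vword u) = 0 := by
      unfold auxCross
      linear_combination (m * vword z 0) * e1 - (m * vword z 1) * e0
    exact (mul_eq_zero.mp this).resolve_left (by positivity)
  have hzu := aux_uniq z u hz hu hc
  subst hzu
  rw [mul_right_cancel₀ (aux_cone z).1.ne' e0]
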